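/- arXiv:2511.19252 — 5 statements merged into one kernel-verified Lean document; each statement's English description precedes it below -/
import Mathlib

section
/- Under the hypotheses of the direct Z-control theorem — namely x_1, …, x_N : ℝ → ℝ^d differentiable with x_i'(t) = ∑_j a_{ij}(t)(x_j(t) − x_i(t)) + u_i(t), A(t) weight-balanced for every t, λ > 0, and u_i(t) = −λ(x_i(t) − x̄(t)) − ∑_j a_{ij}(t)(x_j(t) − x_i(t)) — the consensus parameter Γ(t) := (1/N²) ∑_{i=1}^N ‖x_i(t) − x̄(t)‖² satisfies Γ(t) = e^{−2λ t} Γ(0) for all t ≥ 0; in particular Γ(t) → 0 as t → ∞. -/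
/-- Under the direct Z-control law, the consensus parameter
`Γ t = (1/N²) ∑ i, ‖x i t - x̄ t‖²` satisfies `Γ t = e^{-2 λ t} Γ 0` for all
`t ≥ 0`; in particular `Γ t → 0` as `t → ∞`. -/
theorem direct_Zcontrol_consensus_parameter_decay
    (N d : ℕ) (hN : 1 ≤ N) (lam : ℝ) (hlam : 0 < lam)
    (x : Fin N → ℝ → EuclideanSpace ℝ (Fin d))
    (u : Fin N → ℝ → EuclideanSpace ℝ (Fin d))
    (a : ℝ → Fin N → Fin N → ℝ)
    (hwb : ∀ t i, ∑ j, a t i j = ∑ j, a t j i)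
    (xbar : ℝ → EuclideanSpace ℝ (Fin d))
    (hxbar : ∀ t, xbar t = (N : ℝ)⁻¹ • ∑ i, x i t)
    (hu : ∀ i t, u i t = -(lam • (x i t - xbar t)) - ∑ j, a t i j • (x j t - x i t))
    (hdyn : ∀ i t, HasDerivAt (x i) (∑ j, a t i j • (x j t - x i t) + u i t) t)
    (Γ : ℝ → ℝ)
    (hΓ : ∀ t, Γ t = ((N : ℝ) ^ 2)⁻¹ * ∑ i, ‖x i t - xbar t‖ ^ 2) :
    (∀ t : ℝ, 0 ≤ t → Γ t = Real.exp (-(2 * lam) * t) * Γ 0) ∧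
    Filter.Tendsto Γ Filter.atTop (nhds 0) := by
  have hN0 : (N : ℝ) ≠ 0 := by
    have : N ≠ 0 := by omega
    exact_mod_cast this
  have hx : ∀ i t, HasDerivAt (x i) (-(lam • (x i t - xbar t))) t := by
    intro i t
    have h := hdyn i t
    rw [hu] at h
    convert h using 1
    abel
  have hb : ∀ t, HasDerivAt xbar 0 t := by
    intro t
    have h1 : HasDerivAt (fun t => ∑ i, x i t) (∑ i, -(lam • (x i t - xbar t))) t :=
      HasDerivAt.fun_sum (fun i _ => hx i t)
    have h2 := h1.const_smul ((N : ℝ)⁻¹)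
    have hsum : ∑ i, x i t = (N : ℝ) • xbar t := by
      rw [hxbar, smul_smul, mul_inv_cancel₀ hN0, one_smul]
    have h0 : ∑ i, -(lam • (x i t - xbar t)) = 0 := by
      rw [Finset.sum_neg_distrib, ← Finset.smul_sum, Finset.sum_sub_distrib, hsum]
      simp [Nat.cast_smul_eq_nsmul]
    rw [h0, smul_zero] at h2
    have hf : xbar = fun t => (N : ℝ)⁻¹ • ∑ i, x i t := funext hxbar
    rw [hf]
    exact h2
  have hy : ∀ i t, x i t - xbar t = Real.exp (-lam * t) • (x i 0 - xbar 0) := by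
    intro i t
    have hd : ∀ s, HasDerivAt (fun s => Real.exp (lam * s) • (x i s - xbar s)) 0 s := by
      intro s
      have he : HasDerivAt (fun s : ℝ => Real.exp (lam * s)) (Real.exp (lam * s) * lam) s := by
        have := ((hasDerivAt_id s).const_mul lam).exp
        simpa using this
      have h := he.fun_smul ((hx i s).fun_sub (hb s))
      rw [sub_zero, smul_neg, smul_smul, neg_add_cancel] at h
      exact h
    have hc := is_const_of_deriv_eq_zero (fun s => (hd s).differentiableAt)
      (fun s => (hd s).deriv) t 0
    simp only [mul_zero, Real.exp_zero, one_smul] at hc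
    rw [← hc, smul_smul, ← Real.exp_add]
    simp
  have hG : ∀ t : ℝ, Γ t = Real.exp (-(2 * lam) * t) * Γ 0 := by
    intro t
    rw [hΓ t, hΓ 0, mul_left_comm, Finset.mul_sum _ _ (Real.exp _)]
    congr 1
    refine Finset.sum_congr rfl fun i _ => ?_
    rw [hy i t, norm_smul, mul_pow, Real.norm_eq_abs, sq_abs, ← Real.exp_nat_mul]
    congr 2
    push_cast
    ring
  refine ⟨fun t _ => hG t, ?_⟩
  have h1 : Filter.Tendsto (fun t : ℝ => -(2 * lam) * t) Filter.atTop Filter.atBot :=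
    Filter.tendsto_id.const_mul_atTop_of_neg (by linarith)
  have h2 := (Real.tendsto_exp_atBot.comp h1).mul_const (Γ 0)
  rw [zero_mul] at h2
  rw [funext hG]
  exact h2
end

section
/- Let N ≥ 1, λ ∈ ℝ, let A = (a_{ij}) be a weight-balanced N×N real matrix, let B = (b_{ij}) be a symmetric N×N real matrix, and let x_1,…,x_N, v_1,…,v_N ∈ ℝ^d. Set r_i := ∑_{k=1}^N a_{ik} and v̄ := (1/N) ∑_{i=1}^N v_i, and define for each i: R_i := ∑_{j=1}^N b_{ij} ⟨x_i − x_j, v_i − v_j⟩ (v_j − v_i) + ∑_{j=1}^N ∑_{k=1}^N a_{ij}(a_{jk} − a_{ik}) v_k + r_i² v_i − ∑_{j=1}^N a_{ij} r_j v_j + 2λ ∑_{j=1}^N a_{ij} (v_j − v_i) + λ² (v_i − v̄). Then ∑_{i=1}^N R_i = 0. -/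
open RealInnerProductSpace

/-- Compatibility (zero-sum) condition for the right-hand
side of the indirect Z-control of velocities through positions in the
second-order Cucker–Smale model: with `A` weight-balanced, `B` symmetric,
row sums `r i = ∑ k, a i k` and `v̄` the average of the `v i`, the vectors
`R i` have zero sum. -/
theorem indirect_velocity_control_compatibility
    (N d : ℕ) (hN : 1 ≤ N) (lam : ℝ)
    (a b : Fin N → Fin N → ℝ)
    (hwb : ∀ i, ∑ j, a i j = ∑ j, a j i)
    (hb : ∀ i j, b i j = b j i)
    (x v : Fin N → EuclideanSpace ℝ (Fin d))
    (r : Fin N → ℝ) (hr : ∀ i, r i = ∑ k, a i k)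
    (vbar : EuclideanSpace ℝ (Fin d)) (hvbar : vbar = (N : ℝ)⁻¹ • ∑ i, v i)
    (R : Fin N → EuclideanSpace ℝ (Fin d))
    (hR : ∀ i, R i =
      ∑ j, (b i j * ⟪x i - x j, v i - v j⟫) • (v j - v i)
      + ∑ j, ∑ k, (a i j * (a j k - a i k)) • v k
      + (r i) ^ 2 • v i
      - ∑ j, (a i j * r j) • v j
      + ∑ j, (2 * lam * a i j) • (v j - v i)
      + lam ^ 2 • (v i - vbar)) :
    ∑ i, R i = 0 := by
  have hc : ∀ j, ∑ i, a i j = r j := fun j => by rw [hr, hwb]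
  have h1 : ∑ i, ∑ j, (b i j * ⟪x i - x j, v i - v j⟫) • (v j - v i) = 0 := by
    have h : ∑ i, ∑ j, (b i j * ⟪x i - x j, v i - v j⟫) • (v j - v i)
        = -∑ i, ∑ j, (b i j * ⟪x i - x j, v i - v j⟫) • (v j - v i) := by
      conv_lhs => rw [Finset.sum_comm]
      rw [← Finset.sum_neg_distrib]
      refine Finset.sum_congr rfl fun i _ => ?_
      rw [← Finset.sum_neg_distrib]
      refine Finset.sum_congr rfl fun j _ => ?_
      rw [hb j i, ← neg_sub (x i) (x j), ← neg_sub (v i) (v j), inner_neg_neg, smul_neg, neg_neg]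
    have h' := eq_neg_iff_add_eq_zero.mp h
    rw [← two_smul ℝ] at h'
    exact (smul_eq_zero.mp h').resolve_left two_ne_zero
  have h2 : ∑ i, ∑ j, ∑ k, (a i j * (a j k - a i k)) • v k = 0 := by
    have e1 : ∑ i, ∑ j, ∑ k, (a i j * a j k) • v k = ∑ j, ∑ k, (r j * a j k) • v k := by
      rw [Finset.sum_comm]
      refine Finset.sum_congr rfl fun j _ => ?_
      rw [Finset.sum_comm]
      refine Finset.sum_congr rfl fun k _ => ?_
      rw [← Finset.sum_smul, ← Finset.sum_mul, hc]
    have e2 : ∑ i, ∑ j, ∑ k, (a i j * a i k) • v k = ∑ j, ∑ k, (r j * a j k) • v k := by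
      refine Finset.sum_congr rfl fun j _ => ?_
      rw [Finset.sum_comm]
      refine Finset.sum_congr rfl fun k _ => ?_
      rw [← Finset.sum_smul, ← Finset.sum_mul, hr]
    simp only [mul_sub, sub_smul, Finset.sum_sub_distrib]
    rw [e1, e2, sub_self]
  have h4 : ∑ i, ∑ j, (a i j * r j) • v j = ∑ i, (r i) ^ 2 • v i := by
    rw [Finset.sum_comm]
    refine Finset.sum_congr rfl fun j _ => ?_
    rw [← Finset.sum_smul, ← Finset.sum_mul, hc, sq]
  have h5 : ∑ i, ∑ j, (2 * lam * a i j) • (v j - v i) = 0 := by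
    simp only [smul_sub, Finset.sum_sub_distrib]
    rw [Finset.sum_comm, sub_eq_zero]
    refine Finset.sum_congr rfl fun j _ => ?_
    rw [← Finset.sum_smul, ← Finset.sum_smul, ← Finset.mul_sum, ← Finset.mul_sum, hwb]
  have h6 : ∑ i, lam ^ 2 • (v i - vbar) = 0 := by
    have hN' : (N : ℝ) ≠ 0 := by positivity
    rw [← Finset.smul_sum, Finset.sum_sub_distrib, Finset.sum_const, Finset.card_univ,
      Fintype.card_fin, ← Nat.cast_smul_eq_nsmul ℝ, hvbar, smul_inv_smul₀ hN', sub_self, smul_zero]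
  simp only [hR, Finset.sum_add_distrib, Finset.sum_sub_distrib]
  rw [h1, h2, h4, h5, h6]
  simp
end

section
/- Let N ≥ 1, λ ∈ ℝ, let A = (a_{ij}) be a weight-balanced N×N real matrix, let B = (b_{ij}) be a symmetric N×N real matrix, and let x_1,…,x_N, v_1,…,v_N, z_1,…,z_N ∈ ℝ^d. Set r_i := ∑_{k=1}^N a_{ik} and z̄ := (1/N) ∑_{i=1}^N z_i, and define for each i: R_i := ∑_{j=1}^N b_{ij} ⟨x_i − x_j, v_i − v_j⟩ (z_j − z_i) + ∑_{j=1}^N ∑_{k=1}^N a_{ij}(a_{jk} − a_{ik}) z_k + r_i² z_i − ∑_{j=1}^N a_{ij} r_j z_j + 2λ ∑_{j=1}^N a_{ij} (z_j − z_i) + λ² (z_i − z̄). Then ∑_{i=1}^N R_i = 0. -/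
open RealInnerProductSpace

/-- Compatibility (zero-sum) condition for the right-hand
side of the indirect Z-control of accelerations through positions in the
third-order generalized Cucker–Smale model: with `A` weight-balanced, `B`
symmetric, row sums `r i = ∑ k, a i k` and `z̄` the average of the `z i`, the
vectors `R i` have zero sum. -/
theorem indirect_acceleration_control_via_positions_compatibility
    (N d : ℕ) (hN : 1 ≤ N) (lam : ℝ)
    (a b : Fin N → Fin N → ℝ)
    (hwb : ∀ i, ∑ j, a i j = ∑ j, a j i)
    (hb : ∀ i j, b i j = b j i)
    (x v z : Fin N → EuclideanSpace ℝ (Fin d))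
    (r : Fin N → ℝ) (hr : ∀ i, r i = ∑ k, a i k)
    (zbar : EuclideanSpace ℝ (Fin d)) (hzbar : zbar = (N : ℝ)⁻¹ • ∑ i, z i)
    (R : Fin N → EuclideanSpace ℝ (Fin d))
    (hR : ∀ i, R i =
      ∑ j, (b i j * ⟪x i - x j, v i - v j⟫) • (z j - z i)
      + ∑ j, ∑ k, (a i j * (a j k - a i k)) • z k
      + (r i) ^ 2 • z i
      - ∑ j, (a i j * r j) • z j
      + ∑ j, (2 * lam * a i j) • (z j - z i)
      + lam ^ 2 • (z i - zbar)) :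
    ∑ i, R i = 0 := by
  have hc : ∀ j, ∑ i, a i j = r j := fun j => by rw [hr, hwb]
  have h1 : ∑ i, ∑ j, (b i j * ⟪x i - x j, v i - v j⟫) • (z j - z i) = 0 := by
    have h : ∑ i, ∑ j, (b i j * ⟪x i - x j, v i - v j⟫) • (z j - z i)
        = -∑ i, ∑ j, (b i j * ⟪x i - x j, v i - v j⟫) • (z j - z i) := by
      conv_lhs => rw [Finset.sum_comm]
      rw [← Finset.sum_neg_distrib]
      refine Finset.sum_congr rfl fun i _ => ?_
      rw [← Finset.sum_neg_distrib]
      refine Finset.sum_congr rfl fun j _ => ?_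
      rw [hb j i, ← neg_sub (x i) (x j), ← neg_sub (v i) (v j), inner_neg_neg,
        ← smul_neg, neg_sub]
    have : IsAddTorsionFree (EuclideanSpace ℝ (Fin d)) := .of_isTorsionFree ℝ _
    exact self_eq_neg.mp h
  have h2 : ∑ i, ∑ j, ∑ k, (a i j * (a j k - a i k)) • z k = 0 := by
    have e1 : ∑ i, ∑ j, ∑ k, (a i j * a j k) • z k = ∑ j, ∑ k, (r j * a j k) • z k := by
      rw [Finset.sum_comm]
      refine Finset.sum_congr rfl fun j _ => ?_
      rw [Finset.sum_comm]
      refine Finset.sum_congr rfl fun k _ => ?_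
      rw [← Finset.sum_smul, ← Finset.sum_mul, hc]
    have e2 : ∑ i, ∑ j, ∑ k, (a i j * a i k) • z k = ∑ j, ∑ k, (r j * a j k) • z k := by
      refine Finset.sum_congr rfl fun i _ => ?_
      rw [Finset.sum_comm]
      refine Finset.sum_congr rfl fun k _ => ?_
      rw [← Finset.sum_smul, ← Finset.sum_mul, ← hr]
    simp only [mul_sub, sub_smul, Finset.sum_sub_distrib]
    rw [e1, e2, sub_self]
  have h3 : ∑ i, ∑ j, (a i j * r j) • z j = ∑ i, (r i) ^ 2 • z i := by
    rw [Finset.sum_comm]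
    refine Finset.sum_congr rfl fun j _ => ?_
    rw [← Finset.sum_smul, ← Finset.sum_mul, hc, sq]
  have h4 : ∑ i, ∑ j, (2 * lam * a i j) • (z j - z i) = 0 := by
    simp only [smul_sub, Finset.sum_sub_distrib]
    rw [sub_eq_zero, Finset.sum_comm]
    refine Finset.sum_congr rfl fun j _ => ?_
    rw [← Finset.sum_smul, ← Finset.sum_smul, ← Finset.mul_sum, ← Finset.mul_sum, hwb]
  have h5 : ∑ i, lam ^ 2 • (z i - zbar) = 0 := by
    have hN' : (N : ℝ) ≠ 0 := by
      exact_mod_cast (by omega : N ≠ 0)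
    rw [← Finset.smul_sum, Finset.sum_sub_distrib, Finset.sum_const, Finset.card_univ,
      Fintype.card_fin, ← Nat.cast_smul_eq_nsmul ℝ, hzbar, smul_smul, mul_inv_cancel₀ hN',
      one_smul, sub_self, smul_zero]
  simp only [hR, Finset.sum_add_distrib, Finset.sum_sub_distrib, h1, h2, h3, h4, h5]
  simp
end

section
/- Let N ≥ 1, λ ∈ ℝ, let A = (a_{ij}), C = (c_{ij}), D = (d_{ij}) be N×N real matrices with A weight-balanced and C and D symmetric, and let z_1,…,z_N ∈ ℝ^d. Set r_i := ∑_{k=1}^N a_{ik}, δ_i := ∑_{k=1}^N d_{ik}, z̄ := (1/N) ∑_{i=1}^N z_i, and define for each i: R_i := ∑_j c_{ij}(z_j − z_i) + 2 ∑_{j,k} d_{ij}(a_{jk} − a_{ik}) z_k + 2 r_i δ_i z_i − 2 ∑_j d_{ij} r_j z_j + ∑_{j,k} a_{ij}(d_{jk} − d_{ik}) z_k + ∑_{j,k,ℓ} a_{ij} a_{kℓ} (a_{jk} − a_{ik})(z_k − z_ℓ) − ∑_j a_{ij} δ_j z_j − ∑_{j,k} a_{ij} a_{jk} r_j (z_k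 − z_j) + r_i δ_i z_i + ∑_j a_{ij} r_i² (z_j − z_i) + 3λ ∑_j d_{ij}(z_j − z_i) + 3λ ∑_{j,k} a_{ij}(a_{jk} − a_{ik}) z_k + 3λ r_i² z_i − 3λ ∑_j a_{ij} r_j z_j + 3λ² ∑_j a_{ij}(z_j − z_i) + λ³ (z_i − z̄). Then ∑_{i=1}^N R_i = 0. -/
theorem wb_sum_zero {N : ℕ} {E : Type*} [AddCommGroup E] [Module ℝ E]
    (w : Fin N → Fin N → ℝ) (hw : ∀ i, ∑ j, w i j = ∑ j, w j i) (f : Fin N → E) :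
    ∑ i, ∑ j, w i j • (f j - f i) = 0 := by
  simp only [smul_sub, Finset.sum_sub_distrib]
  rw [Finset.sum_comm]
  simp only [← Finset.sum_smul, hw, sub_self]

/-- Compatibility (zero-sum) condition for the right-hand
side of the indirect Z-control of accelerations through velocities in the
third-order generalized Cucker–Smale model: with `A` weight-balanced, `C` and
`D` symmetric, row sums `r i = ∑ k, a i k`, `δ i = ∑ k, dd i k`, and `z̄` the
average of the `z i`, the vectors `R i` have zero sum. -/
theorem indirect_acceleration_control_via_velocities_compatibility
    (N d : ℕ) (hN : 1 ≤ N) (lam : ℝ)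
    (a c dd : Fin N → Fin N → ℝ)
    (hwb : ∀ i, ∑ j, a i j = ∑ j, a j i)
    (hc : ∀ i j, c i j = c j i)
    (hdd : ∀ i j, dd i j = dd j i)
    (z : Fin N → EuclideanSpace ℝ (Fin d))
    (r : Fin N → ℝ) (hr : ∀ i, r i = ∑ k, a i k)
    (δ : Fin N → ℝ) (hδ : ∀ i, δ i = ∑ k, dd i k)
    (zbar : EuclideanSpace ℝ (Fin d)) (hzbar : zbar = (N : ℝ)⁻¹ • ∑ i, z i)
    (R : Fin N → EuclideanSpace ℝ (Fin d))
    (hR : ∀ i, R i =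
      ∑ j, c i j • (z j - z i)
      + ∑ j, ∑ k, (2 * dd i j * (a j k - a i k)) • z k
      + (2 * r i * δ i) • z i
      - ∑ j, (2 * dd i j * r j) • z j
      + ∑ j, ∑ k, (a i j * (dd j k - dd i k)) • z k
      + ∑ j, ∑ k, ∑ l, (a i j * a k l * (a j k - a i k)) • (z k - z l)
      - ∑ j, (a i j * δ j) • z j
      - ∑ j, ∑ k, (a i j * a j k * r j) • (z k - z j)
      + (r i * δ i) • z i
      + ∑ j, (a i j * r i ^ 2) • (z j - z i)
      + ∑ j, (3 * lam * dd i j) • (z j - z i)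
      + ∑ j, ∑ k, (3 * lam * a i j * (a j k - a i k)) • z k
      + (3 * lam * r i ^ 2) • z i
      - ∑ j, (3 * lam * a i j * r j) • z j
      + ∑ j, (3 * lam ^ 2 * a i j) • (z j - z i)
      + lam ^ 3 • (z i - zbar)) :
    ∑ i, R i = 0 := by
  have hdb : ∀ i, ∑ j, dd i j = ∑ j, dd j i :=
    fun i => Finset.sum_congr rfl fun j _ => hdd i j
  have hcb : ∀ i, ∑ j, c i j = ∑ j, c j i :=
    fun i => Finset.sum_congr rfl fun j _ => hc i j
  have key : ∀ i, R i =
      ∑ j, c i j • (z j - z i)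
      + ∑ j, dd i j • ((∑ k, (2 * a j k) • z k) - ∑ k, (2 * a i k) • z k)
      - ∑ j, dd i j • ((2 * r j) • z j - (2 * r i) • z i)
      + ∑ j, a i j • ((∑ k, dd j k • z k) - ∑ k, dd i k • z k)
      + ∑ j, a i j • ((∑ k, ∑ l, (a k l * a j k) • (z k - z l))
          - ∑ k, ∑ l, (a k l * a i k) • (z k - z l))
      - ∑ j, a i j • (δ j • z j - δ i • z i)
      - ∑ j, a i j • ((∑ k, (a j k * r j) • (z k - z j)) - ∑ k, (a i k * r i) • (z k - z i))
      + ∑ j, dd i j • ((3 * lam) • z j - (3 * lam) • z i)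
      + ∑ j, a i j • ((∑ k, (3 * lam * a j k) • z k) - ∑ k, (3 * lam * a i k) • z k)
      - ∑ j, a i j • ((3 * lam * r j) • z j - (3 * lam * r i) • z i)
      + ∑ j, a i j • ((3 * lam ^ 2) • z j - (3 * lam ^ 2) • z i)
      + lam ^ 3 • (z i - zbar) := by
    intro i
    have e2 : ∑ j, dd i j • ((∑ k, (2 * a j k) • z k) - ∑ k, (2 * a i k) • z k)
        = ∑ j, ∑ k, (2 * dd i j * (a j k - a i k)) • z k := by
      refine Finset.sum_congr rfl fun j _ => ?_
      rw [← Finset.sum_sub_distrib, Finset.smul_sum]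
      exact Finset.sum_congr rfl fun k _ => by module
    have e3 : ∑ j, dd i j • ((2 * r j) • z j - (2 * r i) • z i)
        = ∑ j, (2 * dd i j * r j) • z j - (2 * r i * δ i) • z i := by
      rw [hδ, Finset.mul_sum, Finset.sum_smul, ← Finset.sum_sub_distrib]
      exact Finset.sum_congr rfl fun k _ => by module
    have e5 : ∑ j, a i j • ((∑ k, dd j k • z k) - ∑ k, dd i k • z k)
        = ∑ j, ∑ k, (a i j * (dd j k - dd i k)) • z k := by
      refine Finset.sum_congr rfl fun j _ => ?_
      rw [← Finset.sum_sub_distrib, Finset.smul_sum]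
      exact Finset.sum_congr rfl fun k _ => by module
    have e6 : ∑ j, a i j • ((∑ k, ∑ l, (a k l * a j k) • (z k - z l))
          - ∑ k, ∑ l, (a k l * a i k) • (z k - z l))
        = ∑ j, ∑ k, ∑ l, (a i j * a k l * (a j k - a i k)) • (z k - z l) := by
      refine Finset.sum_congr rfl fun j _ => ?_
      rw [← Finset.sum_sub_distrib, Finset.smul_sum]
      refine Finset.sum_congr rfl fun k _ => ?_
      rw [← Finset.sum_sub_distrib, Finset.smul_sum]
      exact Finset.sum_congr rfl fun l _ => by module
    have e7 : ∑ j, a i j • (δ j • z j - δ i • z i)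
        = ∑ j, (a i j * δ j) • z j - (r i * δ i) • z i := by
      rw [hr, Finset.sum_mul, Finset.sum_smul, ← Finset.sum_sub_distrib]
      exact Finset.sum_congr rfl fun k _ => by module
    have e8 : ∑ j, a i j • ((∑ k, (a j k * r j) • (z k - z j))
          - ∑ k, (a i k * r i) • (z k - z i))
        = ∑ j, ∑ k, (a i j * a j k * r j) • (z k - z j)
          - ∑ j, (a i j * r i ^ 2) • (z j - z i) := by
      simp only [smul_sub (a i _) (∑ k, _) (∑ k, _)]
      rw [Finset.sum_sub_distrib, ← Finset.sum_smul, ← hr]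
      simp only [Finset.smul_sum]
      congr 1
      · exact Finset.sum_congr rfl fun j _ => Finset.sum_congr rfl fun k _ => by module
      · exact Finset.sum_congr rfl fun k _ => by module
    have e9 : ∑ j, dd i j • ((3 * lam) • z j - (3 * lam) • z i)
        = ∑ j, (3 * lam * dd i j) • (z j - z i) :=
      Finset.sum_congr rfl fun k _ => by module
    have e10 : ∑ j, a i j • ((∑ k, (3 * lam * a j k) • z k) - ∑ k, (3 * lam * a i k) • z k)
        = ∑ j, ∑ k, (3 * lam * a i j * (a j k - a i k)) • z k := by
      refine Finset.sum_congr rfl fun j _ => ?_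
      rw [← Finset.sum_sub_distrib, Finset.smul_sum]
      exact Finset.sum_congr rfl fun k _ => by module
    have e11 : ∑ j, a i j • ((3 * lam * r j) • z j - (3 * lam * r i) • z i)
        = ∑ j, (3 * lam * a i j * r j) • z j - (3 * lam * r i ^ 2) • z i := by
      simp only [smul_sub]
      rw [Finset.sum_sub_distrib, ← Finset.sum_smul, ← hr]
      congr 1
      · exact Finset.sum_congr rfl fun k _ => by module
      · module
    have e12 : ∑ j, a i j • ((3 * lam ^ 2) • z j - (3 * lam ^ 2) • z i)
        = ∑ j, (3 * lam ^ 2 * a i j) • (z j - z i) :=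
      Finset.sum_congr rfl fun k _ => by module
    rw [hR, e2, e3, e5, e6, e7, e8, e9, e10, e11, e12]
    abel
  have hlast : ∑ i, lam ^ 3 • (z i - zbar) = 0 := by
    have hN0 : (N : ℝ) ≠ 0 := by positivity
    rw [← Finset.smul_sum, Finset.sum_sub_distrib, Finset.sum_const, Finset.card_univ,
      Fintype.card_fin, hzbar, ← Nat.cast_smul_eq_nsmul ℝ, smul_smul, mul_inv_cancel₀ hN0,
      one_smul, sub_self, smul_zero]
  rw [Finset.sum_congr rfl fun i _ => key i]
  rw [Finset.sum_add_distrib, Finset.sum_add_distrib, Finset.sum_sub_distrib,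
    Finset.sum_add_distrib, Finset.sum_add_distrib, Finset.sum_sub_distrib,
    Finset.sum_sub_distrib, Finset.sum_add_distrib, Finset.sum_add_distrib,
    Finset.sum_sub_distrib, Finset.sum_add_distrib, hlast,
    wb_sum_zero c hcb z,
    wb_sum_zero dd hdb (fun j => ∑ k, (2 * a j k) • z k),
    wb_sum_zero dd hdb (fun j => (2 * r j) • z j),
    wb_sum_zero a hwb (fun j => ∑ k, dd j k • z k),
    wb_sum_zero a hwb (fun j => ∑ k, ∑ l, (a k l * a j k) • (z k - z l)),
    wb_sum_zero a hwb (fun j => δ j • z j),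
    wb_sum_zero a hwb (fun j => ∑ k, (a j k * r j) • (z k - z j)),
    wb_sum_zero dd hdb (fun j => (3 * lam) • z j),
    wb_sum_zero a hwb (fun j => ∑ k, (3 * lam * a j k) • z k),
    wb_sum_zero a hwb (fun j => (3 * lam * r j) • z j),
    wb_sum_zero a hwb (fun j => (3 * lam ^ 2) • z j)]
  simp
end

section
/- Let N ≥ 1, let A = (a_{ij}) be a weight-balanced N×N real matrix, and let z_1, …, z_N ∈ ℝ^d. Then ∑_{i=1}^N ∑_{j=1}^N ∑_{k=1}^N ∑_{ℓ=1}^N a_{ij} a_{kℓ} (a_{jk} − a_{ik}) (z_k − z_ℓ) = 0. -/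
/-- For a weight-balanced `N × N` real matrix `A` and vectors
`z i ∈ ℝ^d`, the quadruple sum
`∑ i ∑ j ∑ k ∑ ℓ, a i j * a k ℓ * (a j k - a i k) • (z k - z ℓ)` vanishes. -/
theorem quadrupleSum_weightBalanced_eq_zero
    (N d : ℕ) (hN : 1 ≤ N)
    (a : Fin N → Fin N → ℝ)
    (hwb : ∀ i, ∑ j, a i j = ∑ j, a j i)
    (z : Fin N → EuclideanSpace ℝ (Fin d)) :
    ∑ i, ∑ j, ∑ k, ∑ l, (a i j * a k l * (a j k - a i k)) • (z k - z l) = 0 := by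
  have key : ∀ i j, ∑ k, ∑ l, (a i j * a k l * (a j k - a i k)) • (z k - z l)
      = a i j • (∑ k, ∑ l, (a j k * a k l) • (z k - z l))
        - a i j • (∑ k, ∑ l, (a i k * a k l) • (z k - z l)) := by
    intro i j
    simp only [Finset.smul_sum, ← Finset.sum_sub_distrib]
    refine Finset.sum_congr rfl fun k _ => Finset.sum_congr rfl fun l _ => ?_
    rw [smul_smul, smul_smul, ← sub_smul]
    congr 1
    ring
  simp only [key]
  simp only [Finset.sum_sub_distrib]
  rw [Finset.sum_comm]
  simp only [← Finset.sum_smul, hwb, sub_self]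
end
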